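/- If a display sequent δ is derivable from a display sequent δ' by a single application of one of the display rules (δ1)–(δ9) or one of the structural rules (Il), (Ir), (ql), (qr), (al), (ar), (pl), (pr), then L_w(δ) ≅ L_w(δ'), i.e. the translated labeled sequents are isomorphic. -/

import Mathlib

set_option linter.unusedVariables false

/-- Formulae of the tense language `L`. -/
inductive Fm : Type where
  | atom : Nat → Fm
  | top : Fm
  | bot : Fm
  | neg : Fm → Fm
  | or : Fm → Fm → Fm
  | and : Fm → Fm → Fm
  | imp : Fm → Fm → Fm
  | box : Fm → Fm
  | dia : Fm → Fm
  | boxP : Fm → Fm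
  | diaP : Fm → Fm
deriving DecidableEq

instance : Inhabited Fm := ⟨Fm.top⟩

/-- Display structures `X ::= A | I | *X | •X | (X∘X)`. -/
inductive Str : Type where
  | fm : Fm → Str
  | I : Str
  | star : Str → Str
  | bullet : Str → Str
  | comp : Str → Str → Str
deriving DecidableEq

/-- Display sequents `X ⊢ Y`. -/
structure DSeq : Type where
  ant : Str
  suc : Str
deriving DecidableEq

/-- Length of a structure. -/
def Str.len : Str → Nat
  | .fm _ => 1
  | .I => 1
  | .star X => X.len + 1
  | .bullet X => X.len + 1
  | .comp X Y => X.len + Y.len + 1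

/-- Length of a display sequent. -/
def DSeq.len (d : DSeq) : Nat := d.ant.len + d.suc.len

/-- The translation `ψ` from formulae of `L_{∧,◇,♦}` to (schematic) structures, where the
structure variable `Ẋ_p` for each atom `p` is instantiated by `θ p`. -/
def psiStr (θ : Nat → Str) : Fm → Str
  | .atom p => θ p
  | .top => .I
  | .and A B => .comp (psiStr θ A) (psiStr θ B)
  | .dia A => .star (.bullet (.star (psiStr θ A)))
  | .diaP A => .bullet (psiStr θ A)
  | _ => .I

/-- Labeled sequents `R, Γ ⇒ Δ`: a set of relational atoms together with multisets of
labeled formulae on the left and on the right. -/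
structure LSeq : Type where
  rel : Finset (Nat × Nat)
  ant : Multiset (Nat × Fm)
  suc : Multiset (Nat × Fm)

/-- The empty labeled sequent. -/
def LSeq.empty : LSeq := ⟨∅, 0, 0⟩
instance : Inhabited LSeq := ⟨LSeq.empty⟩

/-- Sequent composition `⊗`. -/
def LSeq.comp (s t : LSeq) : LSeq := ⟨s.rel ∪ t.rel, s.ant + t.ant, s.suc + t.suc⟩

/-- The labeled sequent `w : A ⇒ ∅`. -/
def Fq (w : Nat) (A : Fm) : LSeq := ⟨∅, {(w, A)}, 0⟩
/-- The labeled sequent `∅ ⇒ w : A`. -/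
def Gq (w : Nat) (A : Fm) : LSeq := ⟨∅, 0, {(w, A)}⟩
/-- The labeled sequent `Rwu ⇒ ∅`. -/
def Rl (w u : Nat) : LSeq := ⟨{(w, u)}, 0, 0⟩

/-- The labels occurring in a labeled sequent. -/
def LSeq.labels (s : LSeq) : Finset Nat :=
  s.rel.image Prod.fst ∪ s.rel.image Prod.snd ∪
    (s.ant.map Prod.fst).toFinset ∪ (s.suc.map Prod.fst).toFinset

/-- The length `|R| + |Γ| + |Δ|` of a labeled sequent. -/
def LSeq.len (s : LSeq) : Nat := s.rel.card + Multiset.card s.ant + Multiset.card s.suc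

/-- Applying a label substitution to a labeled sequent. -/
def LSeq.rename (f : Nat → Nat) (s : LSeq) : LSeq :=
  ⟨s.rel.image (fun e => (f e.1, f e.2)),
   s.ant.map (fun x => (f x.1, x.2)),
   s.suc.map (fun x => (f x.1, x.2))⟩

/-- The (undirected simple) graph of a labeled sequent: labels as vertices, and an edge
between `a` and `b` for each relational atom `Rab`. -/
def LSeq.graph (s : LSeq) : SimpleGraph Nat :=
  SimpleGraph.fromRel (fun a b => (a, b) ∈ s.rel)

/-- `s` is a labeled polytree sequent: (1) if `R = ∅` then `s` is `w`-flat for some `w`;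
(2) if `R ≠ ∅` then every label of `Γ, Δ` occurs in `R`; (3) the graph of `s` is connected
and free of directed and undirected cycles. -/
def IsPolytree (s : LSeq) : Prop :=
  (s.rel = ∅ → ∃ w, (∀ x ∈ s.ant, x.1 = w) ∧ (∀ x ∈ s.suc, x.1 = w)) ∧
  (s.rel ≠ ∅ →
    (∀ x ∈ s.ant, x.1 ∈ s.rel.image Prod.fst ∪ s.rel.image Prod.snd) ∧
    (∀ x ∈ s.suc, x.1 ∈ s.rel.image Prod.fst ∪ s.rel.image Prod.snd)) ∧
  (∀ a, (a, a) ∉ s.rel) ∧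
  (∀ a b, (a, b) ∈ s.rel → (b, a) ∉ s.rel) ∧
  s.graph.IsAcyclic ∧
  (∀ a ∈ s.labels, ∀ b ∈ s.labels, s.graph.Reachable a b)

/-- Isomorphism of labeled sequents: a bijection between the label sets preserving and
reflecting relational atoms and labeled formulae on each side. -/
def LSeq.Iso (s t : LSeq) : Prop :=
  ∃ f : Nat → Nat, Set.BijOn f ↑s.labels ↑t.labels ∧
    (∀ a b, (a, b) ∈ s.rel → (f a, f b) ∈ t.rel) ∧
    (∀ a b, a ∈ s.labels → b ∈ s.labels → (f a, f b) ∈ t.rel → (a, b) ∈ s.rel) ∧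
    (∀ a A, (a, A) ∈ s.ant → (f a, A) ∈ t.ant) ∧
    (∀ a A, a ∈ s.labels → (f a, A) ∈ t.ant → (a, A) ∈ s.ant) ∧
    (∀ a A, (a, A) ∈ s.suc → (f a, A) ∈ t.suc) ∧
    (∀ a A, a ∈ s.labels → (f a, A) ∈ t.suc → (a, A) ∈ s.suc)

/-- The translations `L^w_1` (for `b = true`) and `L^w_2` (for `b = false`) from display
structures to labeled sequents, with root label `w`; the counter `c` supplies fresh
labels. -/
def Lt (b : Bool) : Str → Nat → Nat → LSeq × Nat
  | .fm A, w, c => (if b then Fq w A else Gq w A, c)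
  | .I, _, c => (LSeq.empty, c)
  | .star X, w, c => Lt (!b) X w c
  | .bullet X, w, c =>
      let r := Lt b X c (c + 1)
      ((if b then Rl c w else Rl w c).comp r.1, r.2)
  | .comp X Y, w, c =>
      let r := Lt b X w c
      let t := Lt b Y w r.2
      (r.1.comp t.1, t.2)

/-- The translation `L_w` of display sequents to labeled sequents:
`L_w(X ⊢ Y) = L^w_1(X) ⊗ L^w_2(Y)`. -/
def Ltrans (d : DSeq) (w : Nat) : LSeq :=
  let r := Lt true d.ant w (w + 1)
  r.1.comp (Lt false d.suc w r.2).1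

/-- A single application of one of the display rules `(δ1)`–`(δ9)` or of one of the
structural rules `(Il)`, `(Ir)`, `(ql)`, `(qr)`, `(al)`, `(ar)`, `(pl)`, `(pr)` (the
reversible rules in both directions), as a relation between premise and conclusion. -/
inductive DispStep : DSeq → DSeq → Prop where
  | d1a (X Y Z : Str) : DispStep ⟨.comp X Y, Z⟩ ⟨X, .comp Z (.star Y)⟩
  | d1b (X Y Z : Str) : DispStep ⟨X, .comp Z (.star Y)⟩ ⟨.comp X Y, Z⟩
  | d2a (X Y Z : Str) : DispStep ⟨.comp X Y, Z⟩ ⟨Y, .comp (.star X) Z⟩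
  | d2b (X Y Z : Str) : DispStep ⟨Y, .comp (.star X) Z⟩ ⟨.comp X Y, Z⟩
  | d3a (X Y Z : Str) : DispStep ⟨X, .comp Y Z⟩ ⟨.comp X (.star Z), Y⟩
  | d3b (X Y Z : Str) : DispStep ⟨.comp X (.star Z), Y⟩ ⟨X, .comp Y Z⟩
  | d4a (X Y Z : Str) : DispStep ⟨X, .comp Y Z⟩ ⟨.comp (.star Y) X, Z⟩
  | d4b (X Y Z : Str) : DispStep ⟨.comp (.star Y) X, Z⟩ ⟨X, .comp Y Z⟩
  | d5a (X Y : Str) : DispStep ⟨.star X, Y⟩ ⟨.star Y, X⟩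
  | d5b (X Y : Str) : DispStep ⟨.star Y, X⟩ ⟨.star X, Y⟩
  | d6a (X Y : Str) : DispStep ⟨X, .star Y⟩ ⟨Y, .star X⟩
  | d6b (X Y : Str) : DispStep ⟨Y, .star X⟩ ⟨X, .star Y⟩
  | d7a (X Y : Str) : DispStep ⟨.star (.star X), Y⟩ ⟨X, Y⟩
  | d7b (X Y : Str) : DispStep ⟨X, Y⟩ ⟨.star (.star X), Y⟩
  | d8a (X Y : Str) : DispStep ⟨X, .star (.star Y)⟩ ⟨X, Y⟩
  | d8b (X Y : Str) : DispStep ⟨X, Y⟩ ⟨X, .star (.star Y)⟩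
  | d9a (X Y : Str) : DispStep ⟨X, .bullet Y⟩ ⟨.bullet X, Y⟩
  | d9b (X Y : Str) : DispStep ⟨.bullet X, Y⟩ ⟨X, .bullet Y⟩
  | ila (X Y : Str) : DispStep ⟨X, Y⟩ ⟨.comp .I X, Y⟩
  | ilb (X Y : Str) : DispStep ⟨.comp .I X, Y⟩ ⟨X, Y⟩
  | ira (X Y : Str) : DispStep ⟨X, Y⟩ ⟨X, .comp .I Y⟩
  | irb (X Y : Str) : DispStep ⟨X, .comp .I Y⟩ ⟨X, Y⟩
  | qla (Y : Str) : DispStep ⟨.I, Y⟩ ⟨.star .I, Y⟩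
  | qlb (Y : Str) : DispStep ⟨.star .I, Y⟩ ⟨.I, Y⟩
  | qra (X : Str) : DispStep ⟨X, .I⟩ ⟨X, .star .I⟩
  | qrb (X : Str) : DispStep ⟨X, .star .I⟩ ⟨X, .I⟩
  | ala (X Y Z W : Str) : DispStep ⟨.comp X (.comp Y Z), W⟩ ⟨.comp (.comp X Y) Z, W⟩
  | alb (X Y Z W : Str) : DispStep ⟨.comp (.comp X Y) Z, W⟩ ⟨.comp X (.comp Y Z), W⟩
  | ara (X Y Z W : Str) : DispStep ⟨X, .comp Y (.comp Z W)⟩ ⟨X, .comp (.comp Y Z) W⟩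
  | arb (X Y Z W : Str) : DispStep ⟨X, .comp (.comp Y Z) W⟩ ⟨X, .comp Y (.comp Z W)⟩
  | pl (X Y Z : Str) : DispStep ⟨.comp X Y, Z⟩ ⟨.comp Y X, Z⟩
  | pr (X Y Z : Str) : DispStep ⟨X, .comp Y Z⟩ ⟨X, .comp Z Y⟩

/-! ### Sequent composition and renaming -/

theorem LSeq.comp_assoc (s t u : LSeq) : (s.comp t).comp u = s.comp (t.comp u) := by
  simp [LSeq.comp, Finset.union_assoc, add_assoc]

theorem LSeq.comp_comm (s t : LSeq) : s.comp t = t.comp s := by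
  simp [LSeq.comp, Finset.union_comm, add_comm]

theorem LSeq.comp_left_comm (s t u : LSeq) : s.comp (t.comp u) = t.comp (s.comp u) := by
  rw [← LSeq.comp_assoc, LSeq.comp_comm s t, LSeq.comp_assoc]

@[simp] theorem LSeq.empty_comp (s : LSeq) : LSeq.empty.comp s = s := by
  simp [LSeq.comp, LSeq.empty]

@[simp] theorem LSeq.comp_empty (s : LSeq) : s.comp LSeq.empty = s := by
  simp [LSeq.comp, LSeq.empty]

theorem LSeq.rename_comp (f : Nat → Nat) (s t : LSeq) :
    (s.comp t).rename f = (s.rename f).comp (t.rename f) := by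
  simp [LSeq.comp, LSeq.rename, Finset.image_union]

@[simp] theorem LSeq.rename_id (s : LSeq) : s.rename id = s := by
  simp [LSeq.rename]

@[simp] theorem Rl_rename (f : Nat → Nat) (a b : Nat) : (Rl a b).rename f = Rl (f a) (f b) := by
  simp [LSeq.rename, Rl]

theorem LSeq.labels_rename (f : Nat → Nat) (s : LSeq) :
    (s.rename f).labels = s.labels.image f := by
  ext x
  simp only [LSeq.labels, LSeq.rename, Finset.mem_union, Finset.mem_image, Multiset.mem_toFinset,
    Multiset.mem_map]
  grind

/-- Renaming the labels along an injective map yields an isomorphic labeled sequent. -/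
theorem LSeq.Iso.of_rename {s t : LSeq} {f : Nat → Nat} (hf : Function.Injective f)
    (h : s.rename f = t) : LSeq.Iso s t := by
  subst h
  refine ⟨f, ?_, ?_, ?_, ?_, ?_, ?_, ?_⟩
  · rw [LSeq.labels_rename, Finset.coe_image]
    exact hf.injOn.bijOn_image
  all_goals simp only [LSeq.rename, Finset.mem_image, Multiset.mem_map, Prod.mk.injEq, Prod.exists,
    hf.eq_iff]
  all_goals grind

theorem LSeq.Iso.refl (s : LSeq) : LSeq.Iso s s :=
  .of_rename Function.injective_id s.rename_id

/-! ### Dependence of the translation on the root and the counter -/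

/-- The number of bullets in a structure, i.e. of fresh labels used by its translation. -/
def Str.bullets : Str → Nat
  | .fm _ => 0
  | .I => 0
  | .star X => X.bullets
  | .bullet X => X.bullets + 1
  | .comp X Y => X.bullets + Y.bullets

theorem Lt_snd (b : Bool) (X : Str) (w c : Nat) : (Lt b X w c).2 = c + X.bullets := by
  induction X generalizing b w c with
  | fm A => rfl
  | I => rfl
  | star X ih => exact ih _ _ _
  | bullet X ih => simp only [Lt, Str.bullets, ih]; omega
  | comp X Y ihX ihY => simp only [Lt, Str.bullets, ihX, ihY]; omega

theorem Lt_rename {f : Nat → Nat} (b : Bool) (X : Str) {w w' c c' : Nat} (hw : f w = w')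
    (hc : ∀ i < X.bullets, f (c + i) = c' + i) :
    (Lt b X w c).1.rename f = (Lt b X w' c').1 := by
  induction X generalizing b w w' c c' with
  | fm A => cases b <;> simp [Lt, LSeq.rename, Fq, Gq, hw]
  | I => simp [Lt, LSeq.rename, LSeq.empty]
  | star X ih => exact ih _ hw hc
  | bullet X ih =>
    have h0 : f c = c' := hc 0 (Nat.succ_pos _)
    have h1 : ∀ i < X.bullets, f (c + 1 + i) = c' + 1 + i := fun i hi => by
      have := hc (i + 1) (Nat.succ_lt_succ hi)
      rwa [add_comm i 1, ← add_assoc, ← add_assoc] at this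
    cases b <;> simp [Lt, LSeq.rename_comp, ih _ h0 h1, h0, hw]
  | comp X Y ihX ihY =>
    have hX : ∀ i < X.bullets, f (c + i) = c' + i := fun i hi => hc i (Nat.lt_add_right _ hi)
    have hY : ∀ i < Y.bullets, f (c + X.bullets + i) = c' + X.bullets + i := fun i hi => by
      have := hc (X.bullets + i) (Nat.add_lt_add_left hi _)
      rwa [← add_assoc, ← add_assoc] at this
    simp only [Lt, LSeq.rename_comp, Lt_snd, ihX b hw hX, ihY b hw hY]

/-! ### Swapping adjacent blocks of labels -/

/-- The permutation of `ℕ` exchanging the adjacent intervals `[a, a + p)` and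
`[a + p, a + p + q)`. -/
def blockSwap (a p q n : Nat) : Nat :=
  if n < a then n else if n < a + p then n + q else if n < a + p + q then n - p else n

theorem blockSwap_injective (a p q : Nat) : Function.Injective (blockSwap a p q) := by
  intro m n h
  simp only [blockSwap] at h
  split_ifs at h <;> omega

theorem Lt_swap_iso (b₁ b₂ b₃ b₄ : Bool) (V X Y Z : Str) (w : Nat) :
    LSeq.Iso
      ((Lt b₁ V w (w + 1)).1.comp ((Lt b₂ X w (w + 1 + V.bullets)).1.comp
        ((Lt b₃ Y w (w + 1 + V.bullets + X.bullets)).1.comp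
          (Lt b₄ Z w (w + 1 + V.bullets + X.bullets + Y.bullets)).1)))
      ((Lt b₁ V w (w + 1)).1.comp ((Lt b₃ Y w (w + 1 + V.bullets)).1.comp
        ((Lt b₂ X w (w + 1 + V.bullets + Y.bullets)).1.comp
          (Lt b₄ Z w (w + 1 + V.bullets + Y.bullets + X.bullets)).1))) := by
  have hw : blockSwap (w + 1 + V.bullets) X.bullets Y.bullets w = w := by
    simp only [blockSwap]; split_ifs <;> omega
  refine .of_rename (blockSwap_injective (w + 1 + V.bullets) X.bullets Y.bullets) ?_
  simp only [LSeq.rename_comp]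
  congr 1
  · exact Lt_rename _ _ hw fun i hi => by simp only [blockSwap]; split_ifs <;> omega
  rw [LSeq.comp_left_comm]
  congr 1
  · exact Lt_rename _ _ hw fun i hi => by simp only [blockSwap]; split_ifs <;> omega
  congr 1
  · exact Lt_rename _ _ hw fun i hi => by simp only [blockSwap]; split_ifs <;> omega
  · exact Lt_rename _ _ hw fun i hi => by simp only [blockSwap]; split_ifs <;> omega

theorem Ltrans_bullet_right_iso (X Y : Str) (w : Nat) :
    LSeq.Iso (Ltrans ⟨X, .bullet Y⟩ w) (Ltrans ⟨.bullet X, Y⟩ w) := by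
  refine .of_rename (blockSwap_injective w (X.bullets + 1) 1) ?_
  simp only [Ltrans, Lt, Lt_snd, LSeq.rename_comp, if_true, Bool.false_eq_true, if_false,
    Rl_rename]
  rw [LSeq.comp_left_comm, LSeq.comp_assoc]
  have h0 : blockSwap w (X.bullets + 1) 1 w = w + 1 := by
    simp only [blockSwap]; split_ifs <;> omega
  have h1 : blockSwap w (X.bullets + 1) 1 (w + 1 + X.bullets) = w := by
    simp only [blockSwap]; split_ifs <;> omega
  rw [h0, h1]
  congr 2
  · exact Lt_rename _ _ h0 fun i hi => by simp only [blockSwap]; split_ifs <;> omega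
  · exact Lt_rename _ _ h1 fun i hi => by simp only [blockSwap]; split_ifs <;> omega

theorem Ltrans_bullet_left_iso (X Y : Str) (w : Nat) :
    LSeq.Iso (Ltrans ⟨.bullet X, Y⟩ w) (Ltrans ⟨X, .bullet Y⟩ w) := by
  refine .of_rename (blockSwap_injective w 1 (X.bullets + 1)) ?_
  simp only [Ltrans, Lt, Lt_snd, LSeq.rename_comp, if_true, Bool.false_eq_true, if_false,
    Rl_rename]
  rw [LSeq.comp_left_comm (Lt true X w (w + 1)).1, LSeq.comp_assoc]
  have h0 : blockSwap w 1 (X.bullets + 1) (w + 1) = w := by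
    simp only [blockSwap]; split_ifs <;> omega
  have h1 : blockSwap w 1 (X.bullets + 1) w = w + 1 + X.bullets := by
    simp only [blockSwap]; split_ifs <;> omega
  rw [h0, h1]
  congr 2
  · exact Lt_rename _ _ h0 fun i hi => by simp only [blockSwap]; split_ifs <;> omega
  · exact Lt_rename _ _ h1 fun i hi => by simp only [blockSwap]; split_ifs <;> omega

/-- If `δ` is derivable from `δ'` by a single application of a display
rule `(δ1)`–`(δ9)` or of one of `(Il)`, `(Ir)`, `(ql)`, `(qr)`, `(al)`, `(ar)`, `(pl)`,
`(pr)`, then `L_w(δ) ≅ L_w(δ')`. -/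
theorem dispstep_iso (d' d : DSeq) (w : Nat) (h : DispStep d' d) :
    LSeq.Iso (Ltrans d w) (Ltrans d' w) := by
  cases h
  case d9a X Y => exact Ltrans_bullet_left_iso X Y w
  case d9b X Y => exact Ltrans_bullet_right_iso X Y w
  all_goals simp only [Ltrans, Lt, Lt_snd, LSeq.comp_assoc, Bool.not_true, Bool.not_false,
    LSeq.empty_comp, LSeq.comp_empty]
  case d1a X Y Z => simpa [Lt, Str.bullets] using Lt_swap_iso true false true true X Z Y .I w
  case d1b X Y Z => simpa [Lt, Str.bullets] using Lt_swap_iso true true false true X Y Z .I w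
  case d2a X Y Z => simpa [Lt, Str.bullets] using Lt_swap_iso true true true false .I Y X Z w
  case d2b X Y Z => simpa [Lt, Str.bullets] using Lt_swap_iso true true true false .I X Y Z w
  case d3a X Y Z => simpa [Lt, Str.bullets] using Lt_swap_iso true false false true X Z Y .I w
  case d3b X Y Z => simpa [Lt, Str.bullets] using Lt_swap_iso true false false true X Y Z .I w
  case d4a X Y Z => simpa [Lt, Str.bullets] using Lt_swap_iso true false true false .I Y X Z w
  case d4b X Y Z => simpa [Lt, Str.bullets] using Lt_swap_iso true true false false .I X Y Z w
  case d5a X Y => simpa [Lt, Str.bullets] using Lt_swap_iso true false false true .I Y X .I w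
  case d5b X Y => simpa [Lt, Str.bullets] using Lt_swap_iso true false false true .I X Y .I w
  case d6a X Y => simpa [Lt, Str.bullets] using Lt_swap_iso true true true true .I Y X .I w
  case d6b X Y => simpa [Lt, Str.bullets] using Lt_swap_iso true true true true .I X Y .I w
  case pl X Y Z => simpa [Lt, Str.bullets] using Lt_swap_iso true true true false .I Y X Z w
  case pr X Y Z => simpa [Lt, Str.bullets] using Lt_swap_iso true false false true X Z Y .I w
  all_goals exact .refl _
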